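/- arXiv:2109.05047 — 2 statements merged into one kernel-verified Lean document; each statement's English description precedes it below -/
import Mathlib

section
/- Let K ≥ 2 be an integer, let s : {1,…,K} → ℕ be a vector of counts, and let δ > 0 be real. Suppose f and j are distinct indices such that s(f) ≥ s(i) for all i ∈ {1,…,K} (f is the most frequent index) and s(j) ≥ s(i) for all i ≠ f (j is the second most frequent index). If Beta(1/2; s(f)+1, s(j)+1) ≤ δ/(K-1), then for every index i ≠ f, Beta(1/2; s(f)+1, s(i)+1) ≤ δ/(K-1). In other words, if the most frequent value defeats the second most frequent value in the PPR-Bernoulli pairwise test, then it defeats every other value, so the PPR-1v1 stopping rule needs to monitor only a single test per step. -/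
open Nat

/-- The CDF of the Beta(a, b) distribution (for positive integer parameters) evaluated
at `1/2`: `Beta(1/2; a, b) = ((a+b-1)! / ((a-1)! * (b-1)!)) * ∫₀^{1/2} x^(a-1) (1-x)^(b-1) dx`. -/
noncomputable def betaCdfHalf (a b : ℕ) : ℝ :=
  ((a + b - 1)! : ℝ) / ((a - 1)! * (b - 1)!) *
    ∫ x in (0 : ℝ)..(1 / 2), x ^ (a - 1) * (1 - x) ^ (b - 1)

theorem integral_pow_mul_one_sub_pow_succ (m n : ℕ) (t : ℝ) :
    (m + n + 2) * (∫ x in (0 : ℝ)..t, x ^ m * (1 - x) ^ (n + 1)) -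
      (n + 1) * (∫ x in (0 : ℝ)..t, x ^ m * (1 - x) ^ n) =
      t ^ (m + 1) * (1 - t) ^ (n + 1) := by
  rw [← intervalIntegral.integral_const_mul, ← intervalIntegral.integral_const_mul,
    ← intervalIntegral.integral_sub
      (Continuous.intervalIntegrable (by fun_prop) _ _)
      (Continuous.intervalIntegrable (by fun_prop) _ _),
    intervalIntegral.integral_eq_sub_of_hasDerivAt
      (f := fun x : ℝ => x ^ (m + 1) * (1 - x) ^ (n + 1)) _
      (Continuous.intervalIntegrable (by fun_prop) _ _)]
  · simp
  · intro x _
    refine ((hasDerivAt_pow (m + 1) x).fun_mul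
      (((hasDerivAt_id' x).const_sub 1).fun_pow (n + 1))).congr_deriv ?_
    simp only [Nat.add_sub_cancel]
    push_cast
    ring

theorem betaCdfHalf_monotone (m : ℕ) : Monotone fun n => betaCdfHalf (m + 1) (n + 1) := by
  refine monotone_nat_of_le_succ fun n => ?_
  have key : ((n : ℝ) + 1) * (∫ x in (0 : ℝ)..(1 / 2), x ^ m * (1 - x) ^ n) ≤
      (m + n + 2) * ∫ x in (0 : ℝ)..(1 / 2), x ^ m * (1 - x) ^ (n + 1) := by
    rw [← sub_nonneg, integral_pow_mul_one_sub_pow_succ]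
    norm_num
  have hm : (0 : ℝ) < (m ! : ℝ) := by exact_mod_cast m.factorial_pos
  have hn : (0 : ℝ) < (n ! : ℝ) := by exact_mod_cast n.factorial_pos
  have scaled := mul_le_mul_of_nonneg_left key
    (show (0 : ℝ) ≤ ((m + n + 1)! : ℝ) / (m ! * (n ! * (n + 1))) by positivity)
  simp only [betaCdfHalf, Nat.add_sub_cancel]
  rw [show m + 1 + (n + 1) - 1 = m + n + 1 by omega,
    show m + 1 + (n + 1 + 1) - 1 = m + n + 1 + 1 by omega,
    Nat.factorial_succ (m + n + 1), Nat.factorial_succ n]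
  push_cast
  convert scaled using 1
  · field_simp
  · field_simp
    ring

/-- If the most frequent value defeats the second most frequent value in the
PPR-Bernoulli pairwise test (at threshold `δ/(K-1)`), then it defeats every other
value; hence the PPR-1v1 stopping rule needs to monitor only a single test per step. -/
theorem ppr_1v1_single_test (K : ℕ) (hK : 2 ≤ K) (s : Fin K → ℕ) (δ : ℝ) (hδ : 0 < δ)
    (f j : Fin K) (hfj : f ≠ j)
    (hf : ∀ i : Fin K, s i ≤ s f)
    (hj : ∀ i : Fin K, i ≠ f → s i ≤ s j)
    (h : betaCdfHalf (s f + 1) (s j + 1) ≤ δ / (K - 1)) :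
    ∀ i : Fin K, i ≠ f → betaCdfHalf (s f + 1) (s i + 1) ≤ δ / (K - 1) := by
  exact fun i hi => (betaCdfHalf_monotone (s f) (hj i hi)).trans h
end

section
/- Fix δ ∈ (0,1), an integer K ≥ 2, and reals p₁, p₂, p_j with 0 < p_j ≤ p₂ < p₁ and p₁ + p_j ≤ 1. Set δ' = δ/(2(K-1)), q₁ = p₁/(p₁+p_j), u = (20.775·q₁/(q₁ - 1/2)²) · ln(2.49/((q₁ - 1/2)²·δ')), and t* = (194.07·p₁/(p₁-p₂)²) · ln( √(79.68(K-1)/δ) · p₁/(p₁-p₂) ). Then for every real t > t*, setting l = √( 2·ln(1/δ') / ((p₁+p_j)·t) ), one has u < (1-l)·(p₁+p_j)·t. -/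
open Real

/-- Key calculation in the proof of the PPR-1v1 sample complexity upper bound:
for every `t > t*`, with `l = √(2·ln(1/δ') / ((p₁+p_j)·t))`, the PPR-Bernoulli
sample bound `u` satisfies `u < (1-l)·(p₁+p_j)·t`. -/
theorem ppr_1v1_calculation (δ : ℝ) (hδ0 : 0 < δ) (hδ1 : δ < 1)
    (K : ℕ) (hK : 2 ≤ K)
    (p₁ p₂ pj : ℝ) (hpj0 : 0 < pj) (hpj2 : pj ≤ p₂) (hp21 : p₂ < p₁)
    (hsum : p₁ + pj ≤ 1) :
    ∀ t : ℝ,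
      194.07 * p₁ / (p₁ - p₂) ^ 2 *
          Real.log (Real.sqrt (79.68 * ((K : ℝ) - 1) / δ) * p₁ / (p₁ - p₂)) < t →
      20.775 * (p₁ / (p₁ + pj)) / (p₁ / (p₁ + pj) - 1 / 2) ^ 2 *
          Real.log (2.49 / ((p₁ / (p₁ + pj) - 1 / 2) ^ 2 * (δ / (2 * ((K : ℝ) - 1))))) <
        (1 - Real.sqrt (2 * Real.log (1 / (δ / (2 * ((K : ℝ) - 1)))) / ((p₁ + pj) * t))) *
          (p₁ + pj) * t := by
  intro t ht
  have hK' : (2 : ℝ) ≤ K := by exact_mod_cast hK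
  have ha : 0 < p₁ := by linarith
  have hs : 0 < p₁ + pj := by linarith
  have he : 0 < p₁ - p₂ := by linarith
  have hd : 0 < p₁ - pj := by linarith
  obtain ⟨M, hM⟩ : ∃ M, M = ((K : ℝ) - 1) / δ := ⟨_, rfl⟩
  have hM1 : 1 < M := by rw [hM, lt_div_iff₀ hδ0]; linarith
  have hM0 : 0 < M := by linarith
  have hK1 : (K : ℝ) - 1 ≠ 0 := by linarith
  have hsd : p₁ / (p₁ + pj) - 1 / 2 = (p₁ - pj) / (2 * (p₁ + pj)) := by
    field_simp
    ring
  have hδ' : δ / (2 * ((K : ℝ) - 1)) = 1 / (2 * M) := by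
    rw [hM]
    field_simp
  have hM' : 79.68 * ((K : ℝ) - 1) / δ = 79.68 * M := by rw [hM]; ring
  rw [hM'] at ht
  rw [hsd, hδ']
  obtain ⟨Y, hY⟩ : ∃ Y, Y = Real.log (79.68 * M * (p₁ / (p₁ - pj)) ^ 2) := ⟨_, rfl⟩
  have hr : 1 ≤ p₁ / (p₁ - pj) := by rw [le_div_iff₀ hd]; linarith
  have hr2 : 1 ≤ (p₁ / (p₁ - pj)) ^ 2 := one_le_pow₀ hr
  have hXY : Real.log (2 * M) ≤ Y := by
    rw [hY]
    apply Real.log_le_log (by positivity)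
    nlinarith
  have hX0 : 0 < Real.log (2 * M) := Real.log_pos (by linarith)
  have hY0 : 0 < Y := by linarith
  have hLY : Y / 2 ≤ Real.log (Real.sqrt (79.68 * M) * p₁ / (p₁ - p₂)) := by
    have h : Y / 2 = Real.log (Real.sqrt (79.68 * M) * p₁ / (p₁ - pj)) := by
      have : 79.68 * M * (p₁ / (p₁ - pj)) ^ 2 =
          (Real.sqrt (79.68 * M) * p₁ / (p₁ - pj)) ^ 2 := by
        rw [div_pow, div_pow, mul_pow, Real.sq_sqrt (by positivity)]
        ring
      rw [hY, this, Real.log_pow]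
      push_cast
      ring
    rw [h]
    apply Real.log_le_log (by positivity)
    gcongr
  have ht' : 194.07 * p₁ / (p₁ - pj) ^ 2 * (Y / 2) < t := by
    refine lt_of_le_of_lt ?_ ht
    gcongr
  obtain ⟨R, hR⟩ : ∃ R, R = p₁ * (p₁ + pj) / (p₁ - pj) ^ 2 := ⟨_, rfl⟩
  have hR1 : 1 ≤ R := by
    rw [hR, le_div_iff₀ (by positivity)]
    nlinarith
  have hw : 97.035 * (R * Y) < (p₁ + pj) * t := by
    calc 97.035 * (R * Y) =
          (p₁ + pj) * (194.07 * p₁ / (p₁ - pj) ^ 2 * (Y / 2)) := by rw [hR]; ring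
      _ < (p₁ + pj) * t := by gcongr
  have hRY : Y ≤ R * Y := le_mul_of_one_le_left hY0.le hR1
  have hw0 : 0 < (p₁ + pj) * t := by linarith
  have hl : Real.sqrt (2 * Real.log (1 / (1 / (2 * M))) / ((p₁ + pj) * t)) ≤ 0.1436 := by
    rw [one_div_one_div]
    apply Real.sqrt_le_iff.mpr
    refine ⟨by norm_num, ?_⟩
    rw [div_le_iff₀ hw0]
    linarith
  have hu : 20.775 * (p₁ / (p₁ + pj)) / ((p₁ - pj) / (2 * (p₁ + pj))) ^ 2 = 83.1 * R := by
    rw [hR]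
    field_simp
    norm_num
  have hlog : Real.log (2.49 / (((p₁ - pj) / (2 * (p₁ + pj))) ^ 2 * (1 / (2 * M)))) ≤ Y := by
    have h : 2.49 / (((p₁ - pj) / (2 * (p₁ + pj))) ^ 2 * (1 / (2 * M))) =
        79.68 * M * (((p₁ + pj) / 2) / (p₁ - pj)) ^ 2 := by
      field_simp
      norm_num
    rw [h, hY]
    apply Real.log_le_log (by positivity)
    gcongr
    linarith
  rw [hu, mul_assoc (1 - _)]
  calc _ ≤ 83.1 * R * Y := by gcongr
    _ < (1 - 0.1436) * ((p₁ + pj) * t) := by nlinarith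
    _ ≤ _ := by gcongr
end
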